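/- arXiv:2104.05348 — 15 statements merged into one kernel-verified Lean document; each statement's English description precedes it below -/
import Mathlib

section
/- For every set A : Set α, a list xs : List α has all of its elements in A if and only if for all functions f g : α → Option α satisfying f a = g a for every a ∈ A, one has xs.map f = xs.map g. -/
/-- Setter characterization for the list functor: the elements of `xs` all lie in `A`
iff every pair of functions into `Option α` agreeing on `A` map `xs` to equal lists. -/
theorem list_setter_characterization {α : Type*} (A : Set α) (xs : List α) :
    (∀ a ∈ xs, a ∈ A) ↔
      (∀ f g : α → Option α, (∀ a ∈ A, f a = g a) → xs.map f = xs.map g) := by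
  classical
  refine ⟨fun h f g hfg => List.map_congr_left fun a ha => hfg a (h a ha), fun h a ha => ?_⟩
  by_contra hA
  have hmap := h some (fun x => if x ∈ A then some x else none) fun x hx => by simp [hx]
  simpa [hA] using List.map_inj_left.mp hmap a ha
end

section
/- Let R be a map-respecting equivalence family. If A : Set α is nonempty and xs : List α lies in F_in∼ A, then there exists ys : List α with R xs ys and every element of ys in A. -/
/-- If `R` is a map-respecting equivalence family, `A` is nonempty, and `xs` lies in
`F_in∼ A`, then some `ys` equivalent to `xs` has all its elements in `A`. -/
theorem FIn_subset_of_nonempty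
    (R : ∀ α : Type, List α → List α → Prop)
    (hequiv : ∀ α : Type, Equivalence (R α))
    (hmap : ∀ (α β : Type) (f : α → β) (xs ys : List α),
      R α xs ys → R β (xs.map f) (ys.map f))
    (α : Type) (A : Set α) (hA : A.Nonempty) (xs : List α)
    (hxs : ∀ f g : α → Option α, (∀ a ∈ A, f a = g a) →
      R (Option α) (xs.map f) (xs.map g)) :
    ∃ ys : List α, R α xs ys ∧ ∀ a ∈ ys, a ∈ A := by
  classical
  obtain ⟨a₀, ha₀⟩ := hA
  have h := hmap _ _ (fun o => o.getD a₀) _ _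
    (hxs some (fun a => if a ∈ A then some a else none) fun a ha => by simp [ha])
  simp only [List.map_map, Function.comp_def, Option.getD_some, List.map_id'] at h
  refine ⟨_, h, fun a ha => ?_⟩
  obtain ⟨b, -, rfl⟩ := List.mem_map.1 ha
  by_cases hb : b ∈ A <;> simp [hb, ha₀]
end

section
/- Let R be a map-respecting equivalence family. For every A : Set α and xs : List α, xs lies in F_in∼ A if and only if there exists ys : List (Option α) such that R (xs.map some) ys and every element of ys is either none or equals some a for some a ∈ A. -/
/-- For a map-respecting equivalence family `R`, `xs ∈ F_in∼ A` iff `xs.map some` is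
equivalent to a list whose elements are `none` or `some a` with `a ∈ A`. -/
theorem FIn_iff_equiv_rep
    (R : ∀ α : Type, List α → List α → Prop)
    (hequiv : ∀ α : Type, Equivalence (R α))
    (hmap : ∀ (α β : Type) (f : α → β) (xs ys : List α),
      R α xs ys → R β (xs.map f) (ys.map f))
    (α : Type) (A : Set α) (xs : List α) :
    (∀ f g : α → Option α, (∀ a ∈ A, f a = g a) →
        R (Option α) (xs.map f) (xs.map g)) ↔
      (∃ ys : List (Option α), R (Option α) (xs.map some) ys ∧
        ∀ o ∈ ys, o = none ∨ ∃ a ∈ A, o = some a) := by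
  classical
  constructor
  · intro h
    refine ⟨xs.map fun a => if a ∈ A then some a else none,
      h _ _ fun a ha => (if_pos ha).symm, fun o ho => ?_⟩
    obtain ⟨a, -, rfl⟩ := List.mem_map.1 ho
    by_cases ha : a ∈ A
    · exact .inr ⟨a, ha, if_pos ha⟩
    · exact .inl (if_neg ha)
  · rintro ⟨ys, hR, hys⟩ f g hfg
    have map_bind (k : α → Option α) :
        R (Option α) (xs.map k) (ys.map fun o => o.bind k) := by
      simpa [Function.comp_def] using hmap _ _ (fun o => o.bind k) _ _ hR
    have ys_eq : (ys.map fun o => o.bind f) = ys.map fun o => o.bind g := by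
      refine List.map_congr_left fun o ho => ?_
      rcases hys o ho with rfl | ⟨a, ha, rfl⟩
      · rfl
      · exact hfg a ha
    exact (hequiv _).trans (ys_eq ▸ map_bind f) ((hequiv _).symm (map_bind g))
end

section
/- Let R be a map-respecting equivalence family. For every xs : List α, the intersection of all sets A : Set α for which there exists ys with R xs ys and ys ∈ F_in∼ A equals the intersection, over all ys : List (Option α) with R (xs.map some) ys, of the sets {a | some a ∈ ys}. (Setter characterization: the quotient setter of the class of xs equals ⋂_{ys ∼ xs.map some} {a | some a ∈ ys}.) -/
/-- Setter characterization for the quotient: the intersection of all sets `A` such that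
some `ys` equivalent to `xs` lies in `F_in∼ A` equals the intersection of the sets
`{a | some a ∈ ys}` over all `ys` equivalent to `xs.map some`. -/
theorem quotient_setter_characterization
    (R : ∀ α : Type, List α → List α → Prop)
    (hequiv : ∀ α : Type, Equivalence (R α))
    (hmap : ∀ (α β : Type) (f : α → β) (xs ys : List α),
      R α xs ys → R β (xs.map f) (ys.map f))
    (α : Type) (xs : List α) :
    ⋂₀ {A : Set α | ∃ ys : List α, R α xs ys ∧
        ∀ f g : α → Option α, (∀ a ∈ A, f a = g a) →
          R (Option α) (ys.map f) (ys.map g)} =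
      ⋂ ys ∈ {ys : List (Option α) | R (Option α) (xs.map some) ys},
        {a : α | some a ∈ ys} := by
  classical
  ext a
  simp only [Set.mem_sInter, Set.mem_iInter, Set.mem_ofPred_eq]
  constructor
  · intro h zs hzs
    refine h {b | some b ∈ zs} ⟨xs, (hequiv α).refl xs, fun f g hfg => ?_⟩
    have extend (k : α → Option α) : R (Option α) (xs.map k) (zs.map (·.bind k)) := by
      simpa [Function.comp_def] using hmap _ _ (·.bind k) _ _ hzs
    have agree : zs.map (·.bind f) = zs.map (·.bind g) :=
      List.map_congr_left fun o ho => by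
        cases o with
        | none => rfl
        | some b => exact hfg b ho
    exact (hequiv _).trans (agree ▸ extend f) ((hequiv _).symm (extend g))
  · rintro h A ⟨ys, hxy, hys⟩
    have hsome := h (ys.map fun b => if b ∈ A then some b else none)
      ((hequiv _).trans (hmap _ _ some _ _ hxy) (hys _ _ fun b hb => by simp [hb]))
    obtain ⟨b, -, hb⟩ := List.mem_map.1 hsome
    split_ifs at hb with hbA
    exact Option.some.inj hb ▸ hbA
end

section
/- Let R be an equivalence relation on List α such that for every f : α → α, R xs ys implies R (xs.map f) (ys.map f). Then for every nonempty family 𝒜 of subsets of α with nonempty intersection ⋂₀ 𝒜 and every xs : List α: if for each A ∈ 𝒜 there exists ys with R xs ys and all elements of ys in A, then there exists zs with R xs zs and all elements of zs in ⋂₀ 𝒜. -/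
/-- Any map-respecting equivalence relation on lists preserves nonempty wide
intersections (lists have finitely many elements). -/
theorem map_respecting_preserves_wide_intersections {α : Type*}
    (R : List α → List α → Prop)
    (hequiv : Equivalence R)
    (hmap : ∀ (f : α → α) (xs ys : List α), R xs ys → R (xs.map f) (ys.map f))
    (𝒜 : Set (Set α)) (h𝒜 : 𝒜.Nonempty) (hInter : (⋂₀ 𝒜).Nonempty)
    (xs : List α)
    (h : ∀ A ∈ 𝒜, ∃ ys, R xs ys ∧ ∀ a ∈ ys, a ∈ A) :
    ∃ zs, R xs zs ∧ ∀ a ∈ zs, a ∈ ⋂₀ 𝒜 := by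
  classical
  obtain ⟨c, hc⟩ := hInter
  suffices key : ∀ (bad ys : List α), R xs ys → (∀ a ∈ ys, a ∈ bad ∨ a ∈ ⋂₀ 𝒜) →
      ∃ zs, R xs zs ∧ ∀ a ∈ zs, a ∈ ⋂₀ 𝒜 from
    key xs xs (hequiv.refl xs) fun _ ha => Or.inl ha
  intro bad
  induction bad with
  | nil => exact fun ys hR hys => ⟨ys, hR, fun a ha => (hys a ha).resolve_left List.not_mem_nil⟩
  | cons b bad ih =>
    intro ys hR hys
    by_cases hb : b ∈ ⋂₀ 𝒜
    · refine ih ys hR fun a ha => ?_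
      rcases hys a ha with h' | h'
      · rcases List.mem_cons.1 h' with rfl | h'
        · exact Or.inr hb
        · exact Or.inl h'
      · exact Or.inr h'
    · obtain ⟨A, hA, hbA⟩ : ∃ A ∈ 𝒜, b ∉ A := by simpa using hb
      obtain ⟨ws, hRw, hws⟩ := h A hA
      -- Retract onto `A`, sending everything else to the common point `c`.
      let f : α → α := fun a => if a ∈ A then a else c
      have hfix : ws.map f = ws :=
        (List.map_congr_left fun a ha => if_pos (hws a ha)).trans (List.map_id ws)
      have hRf := hmap f ys ws (hequiv.trans (hequiv.symm hR) hRw)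
      rw [hfix] at hRf
      refine ih (ys.map f) (hequiv.trans hRw (hequiv.symm hRf)) fun a ha => ?_
      obtain ⟨y, hy, rfl⟩ := List.mem_map.1 ha
      by_cases hyA : y ∈ A
      · rw [show f y = y from if_pos hyA]
        refine (hys y hy).imp_left fun h' => (List.mem_cons.1 h').resolve_left ?_
        rintro rfl
        exact hbA hyA
      · rw [show f y = c from if_neg hyA]
        exact Or.inr hc
end

section
/- Let R be a map-respecting equivalence family that preserves wide intersections and preserves preimages. If f g : α → β satisfy f a = g a for every a ∈ setQ xs, then R (xs.map f) (xs.map g). (Congruence of the mapper with respect to the quotient setter.) -/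
/-- The quotient setter: intersection of `{a | some a ∈ ys}` over all `ys` related to
`xs.map some`. -/
def setQ (R : ∀ α : Type, List α → List α → Prop) {α : Type} (xs : List α) : Set α :=
  ⋂ ys ∈ {ys : List (Option α) | R (Option α) (xs.map some) ys}, {a : α | some a ∈ ys}

/-- If `R` preserves wide intersections, then some list related to `xs.map some` has, besides
`none`, only elements of `setQ R xs`. -/
theorem exists_related_subset_setQ (R : ∀ α : Type, List α → List α → Prop)
    (hequiv : ∀ α : Type, Equivalence (R α))
    (hwide : ∀ (α : Type) (𝒜 : Set (Set α)), 𝒜.Nonempty → (⋂₀ 𝒜).Nonempty →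
      ∀ xs : List α,
        (∀ A ∈ 𝒜, ∃ ys, R α xs ys ∧ ∀ a ∈ ys, a ∈ A) →
        ∃ ys, R α xs ys ∧ ∀ a ∈ ys, a ∈ ⋂₀ 𝒜)
    {α : Type} (xs : List α) :
    ∃ ys, R (Option α) (xs.map some) ys ∧ ∀ a, some a ∈ ys → a ∈ setQ R xs := by
  obtain ⟨ys, hys, hmem⟩ := hwide (Option α)
    {A | none ∈ A ∧ ∃ ys, R (Option α) (xs.map some) ys ∧ ∀ o ∈ ys, o ∈ A}
    ⟨Set.univ, trivial, _, (hequiv _).refl _, fun _ _ => trivial⟩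
    ⟨none, fun _ hA => hA.1⟩ (xs.map some) (fun _ hA => hA.2)
  refine ⟨ys, hys, fun a ha => Set.mem_iInter₂.2 fun zs hzs => ?_⟩
  have h := hmem _ ha {o | o = none ∨ o ∈ zs} ⟨Or.inl rfl, zs, hzs, fun _ ho => Or.inr ho⟩
  exact h.resolve_left (Option.some_ne_none a)

/-- Congruence of the mapper with respect to the quotient setter: if `f` and `g` agree
on `setQ xs`, then `xs.map f` and `xs.map g` are equivalent. -/
theorem map_congr_setQ
    (R : ∀ α : Type, List α → List α → Prop)
    (hequiv : ∀ α : Type, Equivalence (R α))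
    (hmap : ∀ (α β : Type) (f : α → β) (xs ys : List α),
      R α xs ys → R β (xs.map f) (ys.map f))
    (hwide : ∀ (α : Type) (𝒜 : Set (Set α)), 𝒜.Nonempty → (⋂₀ 𝒜).Nonempty →
      ∀ xs : List α,
        (∀ A ∈ 𝒜, ∃ ys, R α xs ys ∧ ∀ a ∈ ys, a ∈ A) →
        ∃ ys, R α xs ys ∧ ∀ a ∈ ys, a ∈ ⋂₀ 𝒜)
    (hpre : ∀ (α β : Type) (f : α → β) (A : Set β), (f ⁻¹' A).Nonempty →
      ∀ (xs : List α) (ys : List β), R β (xs.map f) ys → (∀ b ∈ ys, b ∈ A) →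
        ∃ xs' : List α, R α xs xs' ∧ ∀ a ∈ xs', f a ∈ A)
    (α β : Type) (f g : α → β) (xs : List α)
    (hfg : ∀ a ∈ setQ R xs, f a = g a) :
    R β (xs.map f) (xs.map g) := by
  obtain rfl | hne := eq_or_ne xs []
  · exact (hequiv β).refl _
  obtain ⟨a₀, -⟩ := List.exists_mem_of_ne_nil xs hne
  obtain ⟨ys, hys, hmem⟩ := exists_related_subset_setQ R hequiv hwide xs
  have key (h : α → β) : R β (xs.map h) (ys.map fun o => o.elim (f a₀) h) := by
    simpa [Function.comp_def] using hmap _ _ (fun o => o.elim (f a₀) h) _ _ hys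
  have heq : ys.map (fun o => o.elim (f a₀) f) = ys.map fun o => o.elim (f a₀) g := by
    refine List.map_congr_left fun o ho => ?_
    cases o with
    | none => rfl
    | some a => exact hfg a (hmem a ho)
  exact (hequiv β).trans (key f) (heq ▸ (hequiv β).symm (key g))
end

section
/- Let R be a map-respecting equivalence family that preserves wide intersections and preserves preimages. Then the quotient setter is a natural transformation: for every f : α → β and xs : List α, setQ (xs.map f) = f '' (setQ xs), the image of setQ xs under f. -/
/-- The quotient setter is a natural transformation. -/
theorem setQ_natural
    (R : ∀ α : Type, List α → List α → Prop)
    (hequiv : ∀ α : Type, Equivalence (R α))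
    (hmap : ∀ (α β : Type) (f : α → β) (xs ys : List α),
      R α xs ys → R β (xs.map f) (ys.map f))
    (hwide : ∀ (α : Type) (𝒜 : Set (Set α)), 𝒜.Nonempty → (⋂₀ 𝒜).Nonempty →
      ∀ xs : List α,
        (∀ A ∈ 𝒜, ∃ ys, R α xs ys ∧ ∀ a ∈ ys, a ∈ A) →
        ∃ ys, R α xs ys ∧ ∀ a ∈ ys, a ∈ ⋂₀ 𝒜)
    (hpre : ∀ (α β : Type) (f : α → β) (A : Set β), (f ⁻¹' A).Nonempty →
      ∀ (xs : List α) (ys : List β), R β (xs.map f) ys → (∀ b ∈ ys, b ∈ A) →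
        ∃ xs' : List α, R α xs xs' ∧ ∀ a ∈ xs', f a ∈ A)
    (α β : Type) (f : α → β) (xs : List α) :
    setQ R (xs.map f) = f '' setQ R xs := by
  have hcomm : ((xs.map some).map (Option.map f)) = (xs.map f).map some := by
    simp [List.map_map, Function.comp_def]
  ext b
  constructor
  · intro hb
    obtain ⟨ys, hys, hmem⟩ := hwide (Option α)
      {A | none ∈ A ∧ ∃ ys, R (Option α) (xs.map some) ys ∧ ∀ y ∈ ys, y ∈ A}
      ⟨Set.univ, trivial, _, (hequiv _).refl _, fun _ _ => trivial⟩
      ⟨none, fun A hA => hA.1⟩ (xs.map some) (fun A hA => hA.2)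
    have hR := hmap _ _ (Option.map f) _ _ hys
    rw [hcomm] at hR
    have hb' : some b ∈ ys.map (Option.map f) := Set.mem_iInter₂.1 hb _ hR
    obtain ⟨o, ho, hob⟩ := List.mem_map.1 hb'
    obtain ⟨a, rfl, hab⟩ := Option.map_eq_some_iff.1 hob
    refine ⟨a, Set.mem_iInter₂.2 fun zs hzs => ?_, hab⟩
    have hz := hmem _ ho {y | y = none ∨ y ∈ zs}
      ⟨Or.inl rfl, zs, hzs, fun y hy => Or.inr hy⟩
    simpa using hz
  · rintro ⟨a, ha, rfl⟩
    refine Set.mem_iInter₂.2 fun ys hys => ?_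
    obtain ⟨zs, hzs, hmem⟩ := hpre _ _ (Option.map f) {y | y = none ∨ y ∈ ys}
      ⟨none, Or.inl rfl⟩ (xs.map some) ys (hcomm ▸ hys) (fun y hy => Or.inr hy)
    simpa using hmem _ (Set.mem_iInter₂.1 ha zs hzs)
end

section
/- Let R be a map-respecting equivalence family that preserves wide intersections and preserves preimages, and let S : Set (α × β). Then for all xs : List α and ys : List β, the following are equivalent: (1) there exists zs : List (α × β) with setQ zs ⊆ S, R (zs.map Prod.fst) xs, and R (zs.map Prod.snd) ys; (2) there exists ws : List (Option α × Option β) such that every element p of ws satisfies either p = (none, none) or p = (some a, some b) with (a, b) ∈ S, and R (ws.map Prod.fst) (xs.map some) and R (ws.map Prod.snd) (ys.map some). (Relator characterization: the lifted relator equals ∼ composed with the relator of the Option-lifted relation composed with ∼.) -/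
theorem rel_of_rel_map_some {R : ∀ α : Type, List α → List α → Prop}
    (hequiv : ∀ α : Type, Equivalence (R α))
    (hmap : ∀ (α β : Type) (f : α → β) (xs ys : List α),
      R α xs ys → R β (xs.map f) (ys.map f))
    {α : Type} {xs ys : List α} (h : R (Option α) (xs.map some) (ys.map some)) :
    R α xs ys := by
  rcases isEmpty_or_nonempty α with hα | ⟨⟨a⟩⟩
  · rw [Subsingleton.elim xs ys]
    exact (hequiv α).refl ys
  · simpa [Function.comp_def] using hmap _ _ (fun o => o.getD a) _ _ h

theorem exists_rel_map_some_mem_setQ {R : ∀ α : Type, List α → List α → Prop}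
    (hequiv : ∀ α : Type, Equivalence (R α))
    (hwide : ∀ (α : Type) (𝒜 : Set (Set α)), 𝒜.Nonempty → (⋂₀ 𝒜).Nonempty →
      ∀ xs : List α,
        (∀ A ∈ 𝒜, ∃ ys, R α xs ys ∧ ∀ a ∈ ys, a ∈ A) →
        ∃ ys, R α xs ys ∧ ∀ a ∈ ys, a ∈ ⋂₀ 𝒜)
    {α : Type} (xs : List α) :
    ∃ ys, R (Option α) (xs.map some) ys ∧ ∀ a, some a ∈ ys → a ∈ setQ R xs := by
  obtain ⟨ys, hys, hmem⟩ := hwide (Option α)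
    ((fun ys => {o | o = none ∨ o ∈ ys}) '' {ys | R (Option α) (xs.map some) ys})
    ⟨_, xs.map some, (hequiv _).refl _, rfl⟩
    ⟨none, by rintro _ ⟨ys, -, rfl⟩; exact Or.inl rfl⟩ (xs.map some)
    (by rintro _ ⟨ys, hys, rfl⟩; exact ⟨ys, hys, fun _ h => Or.inr h⟩)
  refine ⟨ys, hys, fun a ha => Set.mem_iInter₂.2 fun ys' hys' => ?_⟩
  exact (hmem _ ha _ ⟨ys', hys', rfl⟩).resolve_left (Option.some_ne_none a)

theorem exists_rel_map_some_of_rel_map {R : ∀ α : Type, List α → List α → Prop}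
    (hpre : ∀ (α β : Type) (f : α → β) (A : Set β), (f ⁻¹' A).Nonempty →
      ∀ (xs : List α) (ys : List β), R β (xs.map f) ys → (∀ b ∈ ys, b ∈ A) →
        ∃ xs' : List α, R α xs xs' ∧ ∀ a ∈ xs', f a ∈ A)
    {γ α : Type} [Nonempty γ] (f : γ → α) {us : List (Option γ)} {xs : List α}
    (h : R (Option α) (us.map (Option.map f)) (xs.map some)) :
    ∃ zs : List γ, R (Option γ) us (zs.map some) := by
  obtain ⟨c⟩ := ‹Nonempty γ›
  obtain ⟨us', hus', hsome⟩ := hpre _ _ (Option.map f) (Set.range some)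
    ⟨some c, f c, rfl⟩ us _ h (by simp)
  have hmem : us' ∈ Set.range (List.map (some : γ → Option γ)) := by
    rw [Set.range_list_map]
    rintro (_ | a) ho
    · simpa using hsome _ ho
    · exact ⟨a, rfl⟩
  obtain ⟨zs, rfl⟩ := hmem
  exact ⟨zs, hus'⟩

/-- Relator characterization: the lifted relator equals `∼` composed with the relator of
the `Option`-lifted relation composed with `∼`. -/
theorem relator_characterization
    (R : ∀ α : Type, List α → List α → Prop)
    (hequiv : ∀ α : Type, Equivalence (R α))
    (hmap : ∀ (α β : Type) (f : α → β) (xs ys : List α),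
      R α xs ys → R β (xs.map f) (ys.map f))
    (hwide : ∀ (α : Type) (𝒜 : Set (Set α)), 𝒜.Nonempty → (⋂₀ 𝒜).Nonempty →
      ∀ xs : List α,
        (∀ A ∈ 𝒜, ∃ ys, R α xs ys ∧ ∀ a ∈ ys, a ∈ A) →
        ∃ ys, R α xs ys ∧ ∀ a ∈ ys, a ∈ ⋂₀ 𝒜)
    (hpre : ∀ (α β : Type) (f : α → β) (A : Set β), (f ⁻¹' A).Nonempty →
      ∀ (xs : List α) (ys : List β), R β (xs.map f) ys → (∀ b ∈ ys, b ∈ A) →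
        ∃ xs' : List α, R α xs xs' ∧ ∀ a ∈ xs', f a ∈ A)
    (α β : Type) (S : Set (α × β)) (xs : List α) (ys : List β) :
    (∃ zs : List (α × β), setQ R zs ⊆ S ∧
        R α (zs.map Prod.fst) xs ∧ R β (zs.map Prod.snd) ys) ↔
      (∃ ws : List (Option α × Option β),
        (∀ p ∈ ws, p = (none, none) ∨
          ∃ a b, (a, b) ∈ S ∧ p = (some a, some b)) ∧
        R (Option α) (ws.map Prod.fst) (xs.map some) ∧
        R (Option β) (ws.map Prod.snd) (ys.map some)) := by
  constructor
  · rintro ⟨zs, hS, hxs, hys⟩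
    obtain ⟨us, hus, hmem⟩ := exists_rel_map_some_mem_setQ hequiv hwide zs
    refine ⟨us.map fun o => (o.map Prod.fst, o.map Prod.snd), ?_, ?_, ?_⟩
    · intro p hp
      obtain ⟨_ | ⟨a, b⟩, ho, rfl⟩ := List.mem_map.1 hp
      · exact Or.inl rfl
      · exact Or.inr ⟨a, b, hS (hmem _ ho), rfl⟩
    · have h := hmap _ _ (Option.map Prod.fst) _ _ hus
      have h' := hmap _ _ some _ _ hxs
      simp only [List.map_map, Function.comp_def, Option.map_some] at h h' ⊢
      exact (hequiv _).trans ((hequiv _).symm h) h'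
    · have h := hmap _ _ (Option.map Prod.snd) _ _ hus
      have h' := hmap _ _ some _ _ hys
      simp only [List.map_map, Function.comp_def, Option.map_some] at h h' ⊢
      exact (hequiv _).trans ((hequiv _).symm h) h'
  · rintro ⟨ws, hws, hxs, hys⟩
    rcases isEmpty_or_nonempty α with hα | hα
    · obtain rfl : xs = [] := Subsingleton.elim _ _
      refine ⟨[], fun p _ => isEmptyElim p, (hequiv _).refl _,
        rel_of_rel_map_some hequiv hmap ?_⟩
      have h := hmap _ (Option β) (fun _ => none) _ _ hxs
      have hfst : (ws.map Prod.fst).map (fun _ => (none : Option β)) = ws.map Prod.snd := by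
        rw [List.map_map]
        refine List.map_congr_left fun p hp => ?_
        rcases hws p hp with rfl | ⟨a, -⟩
        exacts [rfl, isEmptyElim a]
      rw [hfst] at h
      exact (hequiv _).trans ((hequiv _).symm h) hys
    rcases isEmpty_or_nonempty β with hβ | hβ
    · obtain rfl : ys = [] := Subsingleton.elim _ _
      refine ⟨[], fun p _ => isEmptyElim p, rel_of_rel_map_some hequiv hmap ?_,
        (hequiv _).refl _⟩
      have h := hmap _ (Option α) (fun _ => none) _ _ hys
      have hsnd : (ws.map Prod.snd).map (fun _ => (none : Option α)) = ws.map Prod.fst := by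
        rw [List.map_map]
        refine List.map_congr_left fun p hp => ?_
        rcases hws p hp with rfl | ⟨_, b, -⟩
        exacts [rfl, isEmptyElim b]
      rw [hsnd] at h
      exact (hequiv _).trans ((hequiv _).symm h) hxs
    obtain ⟨us, hus, rfl⟩ : ∃ us : List (Option (α × β)), (∀ p, some p ∈ us → p ∈ S) ∧
        us.map (fun o => (o.map Prod.fst, o.map Prod.snd)) = ws := by
      have hmem : ws ∈ Set.range (List.map
          fun o : {o : Option (α × β) // ∀ p, o = some p → p ∈ S} =>
            (o.1.map Prod.fst, o.1.map Prod.snd)) := by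
        rw [Set.range_list_map]
        intro p hp
        rcases hws p hp with rfl | ⟨a, b, hab, rfl⟩
        · exact ⟨⟨none, by simp⟩, rfl⟩
        · exact ⟨⟨some (a, b), by rintro _ ⟨⟩; exact hab⟩, rfl⟩
      obtain ⟨us, rfl⟩ := hmem
      refine ⟨us.map Subtype.val, fun p hp => ?_, by simp⟩
      obtain ⟨o, -, ho⟩ := List.mem_map.1 hp
      exact o.2 p ho
    simp only [List.map_map, Function.comp_def] at hxs hys
    obtain ⟨zs, hzs⟩ := exists_rel_map_some_of_rel_map hpre Prod.fst hxs
    refine ⟨zs, fun p hp => hus p (Set.mem_iInter₂.1 hp us ((hequiv _).symm hzs)),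
      rel_of_rel_map_some hequiv hmap ?_, rel_of_rel_map_some hequiv hmap ?_⟩
    · have h := hmap _ _ (Option.map Prod.fst) _ _ hzs
      simp only [List.map_map, Function.comp_def, Option.map_some] at h ⊢
      exact (hequiv _).trans ((hequiv _).symm h) hxs
    · have h := hmap _ _ (Option.map Prod.snd) _ _ hzs
      simp only [List.map_map, Function.comp_def, Option.map_some] at h ⊢
      exact (hequiv _).trans ((hequiv _).symm h) hys
end

section
/- Let R be an equivalence family satisfying subdistributivity: for all types α, β, γ and all relations S : α → β → Prop and T : β → γ → Prop whose composition Comp S T is nonempty, whenever List.Forall₂ S xs us, R us vs, and List.Forall₂ T vs zs, there exist xs' and zs' with R xs xs', List.Forall₂ (Comp S T) xs' zs', and R zs' zs. Then: (a) R is map-respecting, i.e., for every f : α → β, R xs ys implies R (xs.map f) (ys.map f); and (b) R preserves preimages, i.e., for every f : α → β and A : Set β with f ⁻¹' A nonempty, if R (xs.map f) ys and every element of ys lies in A, then there is xs' with R xs xs' and f a ∈ A for every element a of xs'. -/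
/-- Composition of two relations. -/
def Comp {α β γ : Type} (S : α → β → Prop) (T : β → γ → Prop) (a : α) (c : γ) : Prop :=
  ∃ b, S a b ∧ T b c

/-- Subdistributivity implies that the equivalence family is map-respecting and
preserves preimages. -/
theorem subdistributivity_implies_map_respecting_and_preimage_preservation
    (R : ∀ α : Type, List α → List α → Prop)
    (hequiv : ∀ α : Type, Equivalence (R α))
    (hsub : ∀ (α β γ : Type) (S : α → β → Prop) (T : β → γ → Prop),
      (∃ a c, Comp S T a c) →
      ∀ (xs : List α) (us vs : List β) (zs : List γ),
        List.Forall₂ S xs us → R β us vs → List.Forall₂ T vs zs →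
        ∃ (xs' : List α) (zs' : List γ),
          R α xs xs' ∧ List.Forall₂ (Comp S T) xs' zs' ∧ R γ zs' zs) :
    ((∀ (α β : Type) (f : α → β) (xs ys : List α),
        R α xs ys → R β (xs.map f) (ys.map f)) ∧
      (∀ (α β : Type) (f : α → β) (A : Set β), (f ⁻¹' A).Nonempty →
        ∀ (xs : List α) (ys : List β), R β (xs.map f) ys → (∀ b ∈ ys, b ∈ A) →
          ∃ xs' : List α, R α xs xs' ∧ ∀ a ∈ xs', f a ∈ A)) := by
  refine ⟨fun α β f xs ys h => ?_, fun α β f A hA xs ys h hys => ?_⟩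
  · rcases isEmpty_or_nonempty α with hα | ⟨⟨a₀⟩⟩
    · obtain rfl : xs = ys := Subsingleton.elim _ _
      exact (hequiv β).refl _
    · obtain ⟨xs', zs', h₁, h₂, h₃⟩ := hsub β α β (fun b a => b = f a) (fun a b => f a = b)
        ⟨f a₀, f a₀, a₀, rfl, rfl⟩ (xs.map f) xs ys (ys.map f)
        (List.forall₂_map_left_iff.2 (List.forall₂_same.2 fun _ _ => rfl)) h
        (List.forall₂_map_right_iff.2 (List.forall₂_same.2 fun _ _ => rfl))
      obtain rfl : xs' = zs' := by
        rw [← List.forall₂_eq_eq_eq]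
        exact h₂.imp fun _ _ ⟨_, h, h'⟩ => h.trans h'
      exact (hequiv β).trans h₁ h₃
  · obtain ⟨a₀, ha₀⟩ := hA
    obtain ⟨xs', zs', h₁, h₂, -⟩ := hsub α β β (fun a b => f a = b) (fun b c => b = c ∧ b ∈ A)
      ⟨a₀, f a₀, f a₀, rfl, rfl, ha₀⟩ xs (xs.map f) ys ys
      (List.forall₂_map_right_iff.2 (List.forall₂_same.2 fun _ _ => rfl)) h
      (List.forall₂_same.2 fun b hb => ⟨rfl, hys b hb⟩)
    refine ⟨xs', h₁, ?_⟩
    clear h₁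
    induction h₂ with
    | nil => simp
    | cons hac _ ih =>
      obtain ⟨_, rfl, -, hb⟩ := hac
      exact List.forall_mem_cons.2 ⟨hb, ih⟩
end

section
/- Let R be a map-respecting equivalence family, and let W be a family of binary relations on List α (one for each type α) such that: (i) at every type, R is contained in the equivalence closure (EqvGen) of W; (ii) at every type, W is confluent; and (iii) W factors through projections: for every xs : List (α × β) and ys : List α, if W (xs.map Prod.fst) ys then there exists ys' : List (α × β) with ys = ys'.map Prod.fst, R xs ys', and every element of ys' an element of xs, and symmetrically for Prod.snd. Then R satisfies subdistributivity: for all relations S : α → β → Prop and T : β → γ → Prop whose composition Comp S T is nonempty, whenever List.Forall₂ S xs us, R us vs, and List.Forall₂ T vs zs, there exist xs' and zs' with R xs xs', List.Forall₂ (Comp S T) xs' zs', and R zs' zs. -/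
/-- A confluent relation is Church–Rosser: elements identified by its equivalence closure
have a common reduct. -/
theorem Relation.EqvGen.exists_common_reduct {α : Type*} {r : α → α → Prop}
    (hconfl : ∀ a b c, Relation.ReflTransGen r a b → Relation.ReflTransGen r a c →
      ∃ d, Relation.ReflTransGen r b d ∧ Relation.ReflTransGen r c d)
    {x y : α} (h : Relation.EqvGen r x y) :
    ∃ d, Relation.ReflTransGen r x d ∧ Relation.ReflTransGen r y d := by
  induction h with
  | rel x y h => exact ⟨y, .single h, .refl⟩
  | refl x => exact ⟨x, .refl, .refl⟩
  | symm x y _ ih =>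
    obtain ⟨d, hx, hy⟩ := ih
    exact ⟨d, hy, hx⟩
  | trans x y z _ _ ih₁ ih₂ =>
    obtain ⟨d, hx, hyd⟩ := ih₁
    obtain ⟨e, hye, hz⟩ := ih₂
    obtain ⟨k, hdk, hek⟩ := hconfl y d e hyd hye
    exact ⟨k, hx.trans hdk, hz.trans hek⟩

/-- A reduction sequence starting at the image of a list lifts along `f`, up to an equivalence
and without introducing new elements, as soon as single steps do. -/
theorem Relation.ReflTransGen.exists_lift_list_map {α β : Type*} {r : List β → List β → Prop}
    {E : List α → List α → Prop} (hE : Equivalence E) {f : α → β}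
    (hstep : ∀ ps ys, r (ps.map f) ys → ∃ qs, ys = qs.map f ∧ E ps qs ∧ ∀ q ∈ qs, q ∈ ps)
    {ps : List α} {ys : List β} (h : Relation.ReflTransGen r (ps.map f) ys) :
    ∃ qs, ys = qs.map f ∧ E ps qs ∧ ∀ q ∈ qs, q ∈ ps := by
  induction h with
  | refl => exact ⟨ps, rfl, hE.refl ps, fun _ h => h⟩
  | tail _ hr ih =>
    obtain ⟨qs, rfl, hpq, hsub⟩ := ih
    obtain ⟨ts, rfl, hqt, hsub'⟩ := hstep qs _ hr
    exact ⟨ts, rfl, hE.trans hpq hqt, fun t ht => hsub t (hsub' t ht)⟩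

/-- Related lists are the two projections of a list of related pairs. -/
theorem List.Forall₂.exists_list_prod {α β : Type*} {S : α → β → Prop} {xs : List α}
    {ys : List β} (h : List.Forall₂ S xs ys) :
    ∃ ps : List (α × β), ps.map Prod.fst = xs ∧ ps.map Prod.snd = ys ∧ ∀ p ∈ ps, S p.1 p.2 := by
  induction h with
  | nil => exact ⟨[], rfl, rfl, by simp⟩
  | @cons a b _ _ hab _ ih =>
    obtain ⟨ps, rfl, rfl, hps⟩ := ih
    exact ⟨(a, b) :: ps, rfl, rfl, List.forall_mem_cons.2 ⟨hab, hps⟩⟩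

/-- Lists of related pairs which agree on the middle component compose. -/
theorem List.forall₂_comp_of_map_snd_eq_map_fst {α β γ : Type} {S : α → β → Prop}
    {T : β → γ → Prop} {ps : List (α × β)} {qs : List (β × γ)}
    (h : ps.map Prod.snd = qs.map Prod.fst)
    (hps : ∀ p ∈ ps, S p.1 p.2) (hqs : ∀ q ∈ qs, T q.1 q.2) :
    List.Forall₂ (Comp S T) (ps.map Prod.fst) (qs.map Prod.snd) := by
  induction ps generalizing qs with
  | nil =>
    obtain rfl : qs = [] := by simpa using h.symm
    exact .nil
  | cons p ps ih =>
    cases qs with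
    | nil => simp at h
    | cons q qs =>
      simp only [List.map_cons, List.cons.injEq] at h
      rw [List.forall_mem_cons] at hps hqs
      exact .cons ⟨p.2, hps.1, h.1 ▸ hqs.1⟩ (ih h.2 hps.2 hqs.2)

/-- Subdistributivity via confluent relations: if `R` is contained in the equivalence
closure of a confluent family `W` which factors through projections, then `R` satisfies
subdistributivity. -/
theorem subdistributivity_via_confluence
    (R W : ∀ α : Type, List α → List α → Prop)
    (hequiv : ∀ α : Type, Equivalence (R α))
    (hmap : ∀ (α β : Type) (f : α → β) (xs ys : List α),
      R α xs ys → R β (xs.map f) (ys.map f))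
    (hRW : ∀ (α : Type) (xs ys : List α), R α xs ys → Relation.EqvGen (W α) xs ys)
    (hconfl : ∀ (α : Type) (a b c : List α),
      Relation.ReflTransGen (W α) a b → Relation.ReflTransGen (W α) a c →
      ∃ d, Relation.ReflTransGen (W α) b d ∧ Relation.ReflTransGen (W α) c d)
    (hfst : ∀ (α β : Type) (xs : List (α × β)) (ys : List α),
      W α (xs.map Prod.fst) ys →
      ∃ ys' : List (α × β), ys = ys'.map Prod.fst ∧ R (α × β) xs ys' ∧
        ∀ p ∈ ys', p ∈ xs)
    (hsnd : ∀ (α β : Type) (xs : List (α × β)) (ys : List β),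
      W β (xs.map Prod.snd) ys →
      ∃ ys' : List (α × β), ys = ys'.map Prod.snd ∧ R (α × β) xs ys' ∧
        ∀ p ∈ ys', p ∈ xs)
    (α β γ : Type) (S : α → β → Prop) (T : β → γ → Prop)
    (hne : ∃ a c, Comp S T a c)
    (xs : List α) (us vs : List β) (zs : List γ)
    (hxu : List.Forall₂ S xs us) (huv : R β us vs) (hvz : List.Forall₂ T vs zs) :
    ∃ (xs' : List α) (zs' : List γ),
      R α xs xs' ∧ List.Forall₂ (Comp S T) xs' zs' ∧ R γ zs' zs := by
  obtain ⟨d, hud, hvd⟩ := (hRW β us vs huv).exists_common_reduct (hconfl β)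
  obtain ⟨ps, rfl, rfl, hps⟩ := hxu.exists_list_prod
  obtain ⟨qs, rfl, rfl, hqs⟩ := hvz.exists_list_prod
  obtain ⟨ps', rfl, hpp, hp⟩ := hud.exists_lift_list_map (hequiv (α × β)) (hsnd α β)
  obtain ⟨qs', hd, hqq, hq⟩ := hvd.exists_lift_list_map (hequiv (β × γ)) (hfst β γ)
  exact ⟨ps'.map Prod.fst, qs'.map Prod.snd, hmap _ _ _ _ _ hpp,
    List.forall₂_comp_of_map_snd_eq_map_fst hd (fun p h => hps p (hp p h))
      (fun q h => hqs q (hq q h)),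
    (hequiv γ).symm (hmap _ _ _ _ _ hqq)⟩
end

section
/- The duplicate-insertion relation D on List α, defined by D l l' iff there exist xs, x, ys with x ∈ ys, l = xs ++ ys, and l' = xs ++ x :: ys, is confluent: whenever ReflTransGen D a b and ReflTransGen D a c, there exists d with ReflTransGen D b d and ReflTransGen D c d. -/
/-- The duplicate-insertion relation: insert a copy of `x` in front of a suffix `ys`
that already contains `x`. -/
def DupIns {α : Type*} (l l' : List α) : Prop :=
  ∃ (xs : List α) (x : α) (ys : List α), x ∈ ys ∧ l = xs ++ ys ∧ l' = xs ++ x :: ys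

/-- Two insertions in front of nested suffixes commute. -/
theorem dupIns_commute {α : Type*} (xs ts vs : List α) {x u : α}
    (hx : x ∈ ts ++ vs) (hu : u ∈ vs) :
    DupIns (xs ++ x :: (ts ++ vs)) (xs ++ x :: (ts ++ u :: vs)) ∧
      DupIns (xs ++ (ts ++ u :: vs)) (xs ++ x :: (ts ++ u :: vs)) :=
  ⟨⟨xs ++ x :: ts, u, vs, hu, by simp, by simp⟩,
    ⟨xs, x, ts ++ u :: vs, by simp only [List.mem_append, List.mem_cons] at hx ⊢; tauto,
      rfl, rfl⟩⟩

/-- The duplicate-insertion relation has the diamond property. -/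
theorem dupIns_diamond {α : Type*} {a b c : List α} (hab : DupIns a b) (hac : DupIns a c) :
    ∃ d, DupIns b d ∧ DupIns c d := by
  obtain ⟨xs, x, ys, hx, rfl, rfl⟩ := hab
  obtain ⟨us, u, vs, hu, h, rfl⟩ := hac
  rcases List.append_eq_append_iff.mp h with ⟨ts, rfl, rfl⟩ | ⟨ts, rfl, rfl⟩
  · have := dupIns_commute xs ts vs hx hu
    exact ⟨_, this.1, by simpa using this.2⟩
  · have := dupIns_commute us ts ys hu hx
    exact ⟨_, by simpa using this.2, this.1⟩

/-- The duplicate-insertion relation is confluent. -/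
theorem dupIns_confluent {α : Type*} (a b c : List α)
    (hab : Relation.ReflTransGen DupIns a b)
    (hac : Relation.ReflTransGen DupIns a c) :
    ∃ d, Relation.ReflTransGen DupIns b d ∧ Relation.ReflTransGen DupIns c d := by
  exact Relation.church_rosser (fun _ _ _ h₁ h₂ =>
    let ⟨d, hb, hc⟩ := dupIns_diamond h₁ h₂
    ⟨d, .single hb, .single hc⟩) hab hac
end

section
/- The square-duplication relation I on List α, defined by I l l' iff there exist xs, ys, zs with l = xs ++ ys ++ zs and l' = xs ++ ys ++ ys ++ zs, is confluent: whenever ReflTransGen I a b and ReflTransGen I a c, there exists d with ReflTransGen I b d and ReflTransGen I c d. -/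
/-- The square-duplication relation: duplicate a contiguous segment `ys`. -/
def SqDup {α : Type*} (l l' : List α) : Prop :=
  ∃ xs ys zs : List α, l = xs ++ ys ++ zs ∧ l' = xs ++ ys ++ ys ++ zs

/-- Simultaneous duplication of pairwise disjoint contiguous segments. -/
inductive ParDup {α : Type*} : List α → List α → Prop
  | nil : ParDup [] []
  | cons (x : α) {l l' : List α} : ParDup l l' → ParDup (x :: l) (x :: l')
  | dup (r : List α) {l l' : List α} : ParDup l l' → ParDup (r ++ l) (r ++ r ++ l')

namespace ParDup

variable {α : Type*}

theorem refl (l : List α) : ParDup l l := by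
  induction l with
  | nil => exact nil
  | cons x l ih => exact ih.cons x

theorem append {a a' b b' : List α} (ha : ParDup a a') (hb : ParDup b b') :
    ParDup (a ++ b) (a' ++ b') := by
  induction ha with
  | nil => exact hb
  | cons x _ ih => exact ih.cons x
  | dup r _ ih => simpa only [List.append_assoc] using ih.dup r

theorem double (r : List α) : ParDup r (r ++ r) := by
  simpa using nil.dup r

end ParDup

namespace SqDup

variable {α : Type*}

theorem append_left (p : List α) {l l' : List α} (h : SqDup l l') : SqDup (p ++ l) (p ++ l') := by
  obtain ⟨xs, ys, zs, rfl, rfl⟩ := h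
  exact ⟨p ++ xs, ys, zs, by simp, by simp⟩

theorem parDup {l l' : List α} (h : SqDup l l') : ParDup l l' := by
  obtain ⟨xs, ys, zs, rfl, rfl⟩ := h
  simpa using ((ParDup.refl xs).append (ParDup.double ys)).append (ParDup.refl zs)

end SqDup

namespace ParDup

variable {α : Type*}

theorem reflTransGen {l l' : List α} (h : ParDup l l') : Relation.ReflTransGen SqDup l l' := by
  induction h with
  | nil => exact .refl
  | cons x _ ih => exact ih.lift (x :: ·) fun _ _ h => h.append_left [x]
  | @dup r l l' _ ih =>
    exact (ih.lift (r ++ ·) fun _ _ h => h.append_left r).tail ⟨[], r, l', by simp, by simp⟩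

/-- At most one duplicated segment, here `u ++ v`, straddles a given cut point. -/
theorem exists_of_append {p q b : List α} (h : ParDup (p ++ q) b) :
    ∃ p₁ u v q₂ p₁' q₂', p = p₁ ++ u ∧ q = v ++ q₂ ∧ ParDup p₁ p₁' ∧ ParDup q₂ q₂' ∧
      b = p₁' ++ (u ++ v ++ (u ++ v)) ++ q₂' := by
  generalize ha : p ++ q = a at h
  induction h generalizing p with
  | nil =>
    obtain ⟨rfl, rfl⟩ := List.append_eq_nil_iff.1 ha
    exact ⟨[], [], [], [], [], [], rfl, rfl, nil, nil, rfl⟩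
  | cons x h ih =>
    rcases p with _ | ⟨y, p⟩
    · exact ⟨[], [], [], _, [], _, rfl, ha, nil, h.cons x, rfl⟩
    · obtain ⟨rfl, hl⟩ := List.cons.inj ha
      obtain ⟨p₁, u, v, q₂, p₁', q₂', rfl, rfl, hp, hq, rfl⟩ := ih hl
      exact ⟨y :: p₁, u, v, q₂, y :: p₁', q₂', rfl, rfl, hp.cons y, hq, rfl⟩
  | dup r h ih =>
    rcases List.append_eq_append_iff.1 ha with ⟨w, rfl, rfl⟩ | ⟨w, rfl, hl⟩
    · exact ⟨[], p, w, _, [], _, rfl, rfl, nil, h, by simp⟩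
    · obtain ⟨p₁, u, v, q₂, p₁', q₂', rfl, rfl, hp, hq, rfl⟩ := ih hl.symm
      exact ⟨r ++ p₁, u, v, q₂, r ++ r ++ p₁', q₂', by simp, rfl, hp.dup r, hq, by simp⟩

theorem strip {a b c : List α} (hab : ParDup a b) (hac : SqDup a c) :
    ∃ d, Relation.ReflTransGen SqDup b d ∧ ParDup c d := by
  obtain ⟨xs, ys, zs, rfl, rfl⟩ := hac
  rw [List.append_assoc] at hab
  obtain ⟨p, u, v, q, p', q', rfl, hq, hp, hqq, rfl⟩ := hab.exists_of_append
  rcases List.append_eq_append_iff.1 hq with ⟨w, rfl, rfl⟩ | ⟨m, rfl, rfl⟩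
  · refine ⟨p' ++ (u ++ ys ++ ys ++ w ++ (u ++ ys ++ ys ++ w)) ++ q', ?_, ?_⟩
    · refine .head (b := p' ++ (u ++ ys ++ ys ++ w ++ (u ++ ys ++ w)) ++ q') ?_ (.single ?_)
      · exact ⟨p' ++ u, ys, w ++ (u ++ ys ++ w) ++ q', by simp, by simp⟩
      · exact ⟨p' ++ (u ++ ys ++ ys ++ w ++ u), ys, w ++ q', by simp, by simp⟩
    · simpa using (hp.append (double (u ++ ys ++ ys ++ w))).append hqq
  · obtain ⟨m, s, t, q, m', q', rfl, rfl, hm, hq, rfl⟩ := hqq.exists_of_append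
    refine ⟨p' ++ (u ++ v ++ (u ++ v)) ++ m' ++ (s ++ v) ++ m' ++ (s ++ t ++ (s ++ t)) ++ q',
      .single ?_, ?_⟩
    · exact ⟨p' ++ (u ++ v ++ u), v ++ m' ++ s, t ++ (s ++ t) ++ q', by simp, by simp⟩
    · simpa using (((((hp.append (double (u ++ v))).append hm).append (refl (s ++ v))).append
        hm).append (double (s ++ t))).append hq

theorem commute {a b c : List α} (hab : ParDup a b) (hac : Relation.ReflTransGen SqDup a c) :
    ∃ d, Relation.ReflTransGen SqDup b d ∧ ParDup c d := by
  induction hac with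
  | refl => exact ⟨b, .refl, hab⟩
  | tail _ h ih =>
    obtain ⟨d, hbd, hd⟩ := ih
    obtain ⟨e, hde, he⟩ := hd.strip h
    exact ⟨e, hbd.trans hde, he⟩

end ParDup

/-- The square-duplication relation is confluent. -/
theorem sqDup_confluent {α : Type*} (a b c : List α)
    (hab : Relation.ReflTransGen SqDup a b)
    (hac : Relation.ReflTransGen SqDup a c) :
    ∃ d, Relation.ReflTransGen SqDup b d ∧ Relation.ReflTransGen SqDup c d := by
  induction hab with
  | refl => exact ⟨c, hac, .refl⟩
  | tail _ h ih =>
    obtain ⟨d, hbd, hcd⟩ := ih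
    obtain ⟨e, hbe, hde⟩ := h.parDup.commute hbd
    exact ⟨e, hbe, hcd.trans hde.reflTransGen⟩
end

section
/- For any type α containing three pairwise distinct elements a, b, c, the square-removal relation I' on List α, defined by I' l l' iff there exist xs, ys, zs with l = xs ++ ys ++ ys ++ zs and l' = xs ++ ys ++ zs, is not confluent. In particular, the list [a,b,a,b,c,b,a,b,c] reduces under the reflexive-transitive closure of I' both to [a,b,c] and to [a,b,c,b,a,b,c], and these two lists have no common reduct. -/
/-- The square-removal relation: remove one copy of a duplicated contiguous segment. -/
def SqRem {α : Type*} (l l' : List α) : Prop :=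
  ∃ xs ys zs : List α, l = xs ++ ys ++ ys ++ zs ∧ l' = xs ++ ys ++ zs

/-- A list reduces to another list only if it contains a nonempty square, expressed by indices. -/
theorem SqRem.eq_or_exists_getElem?_eq {α : Type*} {l l' : List α} (h : SqRem l l') :
    l' = l ∨ ∃ i p, 0 < p ∧ i + 2 * p ≤ l.length ∧ ∀ j < p, l[i + j]? = l[i + p + j]? := by
  obtain ⟨xs, ys, zs, rfl, rfl⟩ := h
  rcases ys.eq_nil_or_concat with rfl | hys
  · simp
  · refine .inr ⟨xs.length, ys.length, ?_, ?_, fun j hj => ?_⟩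
    · obtain ⟨L, y, rfl⟩ := hys
      simp
    · simp only [List.length_append]
      omega
    · simp [List.append_assoc, List.getElem?_append, Nat.add_assoc, hj]

/-- A list without nonempty squares reduces only to itself. -/
theorem eq_of_reflTransGen_sqRem {α : Type*} {l l' : List α}
    (hl : ∀ i p, 0 < p → i + 2 * p ≤ l.length → ∃ j < p, l[i + j]? ≠ l[i + p + j]?)
    (h : Relation.ReflTransGen SqRem l l') : l' = l := by
  induction h with
  | refl => rfl
  | tail _ h ih =>
    subst ih
    rcases h.eq_or_exists_getElem?_eq with h | ⟨i, p, hp, hip, h⟩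
    · exact h
    · obtain ⟨j, hj, hne⟩ := hl i p hp hip
      exact absurd (h j hj) hne

/-- For a type with three pairwise distinct elements, the square-removal relation is not
confluent: `[a,b,a,b,c,b,a,b,c]` reduces both to `[a,b,c]` and to `[a,b,c,b,a,b,c]`,
which have no common reduct. -/
theorem sqRem_not_confluent {α : Type*} (a b c : α)
    (hab : a ≠ b) (hac : a ≠ c) (hbc : b ≠ c) :
    (¬ ∀ x y z : List α, Relation.ReflTransGen SqRem x y →
        Relation.ReflTransGen SqRem x z →
        ∃ w, Relation.ReflTransGen SqRem y w ∧ Relation.ReflTransGen SqRem z w) ∧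
    Relation.ReflTransGen SqRem [a, b, a, b, c, b, a, b, c] [a, b, c] ∧
    Relation.ReflTransGen SqRem [a, b, a, b, c, b, a, b, c] [a, b, c, b, a, b, c] ∧
    ¬ ∃ d, Relation.ReflTransGen SqRem [a, b, c] d ∧
        Relation.ReflTransGen SqRem [a, b, c, b, a, b, c] d := by
  have hred : Relation.ReflTransGen SqRem [a, b, a, b, c, b, a, b, c] [a, b, c] :=
    .tail (.single ⟨[a], [b, a, b, c], [], rfl, rfl⟩) ⟨[], [a, b], [c], rfl, rfl⟩
  have hred' : Relation.ReflTransGen SqRem [a, b, a, b, c, b, a, b, c] [a, b, c, b, a, b, c] :=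
    .single ⟨[], [a, b], [c, b, a, b, c], rfl, rfl⟩
  have hno : ¬ ∃ d, Relation.ReflTransGen SqRem [a, b, c] d ∧
      Relation.ReflTransGen SqRem [a, b, c, b, a, b, c] d := by
    rintro ⟨d, hd, hd'⟩
    have h₁ : d = [a, b, c] := by
      refine eq_of_reflTransGen_sqRem (fun i p hp hip => ?_) hd
      simp only [List.length_cons, List.length_nil] at hip
      obtain rfl : p = 1 := by omega
      have hi : i ≤ 1 := by omega
      interval_cases i <;> simp [hab, hbc]
    have h₂ : d = [a, b, c, b, a, b, c] := by
      refine eq_of_reflTransGen_sqRem (fun i p hp hip => ?_) hd'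
      simp only [List.length_cons, List.length_nil] at hip
      have hp' : p ≤ 3 := by omega
      have hi : i ≤ 5 := by omega
      interval_cases p <;> interval_cases i <;>
        first
        | omega
        | (refine ⟨0, by simp, ?_⟩; simp [hab, hac, hbc, hab.symm, hac.symm, hbc.symm]; done)
        | (refine ⟨1, by simp, ?_⟩; simp [hac, hac.symm])
    simp [h₁] at h₂
  exact ⟨fun h => hno (h _ _ _ hred hred'), hred, hred', hno⟩
end

section
/- The relation ⇝aci on regular expressions re α is confluent: whenever ReflTransGen ⇝aci r s and ReflTransGen ⇝aci r t, there exists u with ReflTransGen ⇝aci s u and ReflTransGen ⇝aci t u. -/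
/-- Regular expressions. -/
inductive Re (α : Type*) where
  | Zero : Re α
  | Eps : Re α
  | Atom (a : α) : Re α
  | Alt (r s : Re α) : Re α
  | Conc (r s : Re α) : Re α
  | Star (r : Re α) : Re α

/-- The ACI rewrite relation on regular expressions. -/
inductive AciStep {α : Type*} : Re α → Re α → Prop where
  | assocR (r s t : Re α) : AciStep (.Alt (.Alt r s) t) (.Alt r (.Alt s t))
  | assocL (r s t : Re α) : AciStep (.Alt r (.Alt s t)) (.Alt (.Alt r s) t)
  | comm (r s : Re α) : AciStep (.Alt r s) (.Alt s r)
  | idem (r : Re α) : AciStep r (.Alt r r)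
  | refl (r : Re α) : AciStep r r
  | alt {r r' s s' : Re α} : AciStep r r' → AciStep s s' →
      AciStep (.Alt r s) (.Alt r' s')
  | conc {r r' s s' : Re α} : AciStep r r' → AciStep s s' →
      AciStep (.Conc r s) (.Conc r' s')
  | star {r r' : Re α} : AciStep r r' → AciStep (.Star r) (.Star r')

open Relation in
/-- Two-argument congruence for reflexive-transitive closures of a reflexive relation. -/
theorem Relation.ReflTransGen.lift_binary {β : Type*} {W : β → β → Prop} {f : β → β → β}
    (hW : ∀ x, W x x) (hf : ∀ {x x' y y'}, W x x' → W y y' → W (f x y) (f x' y'))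
    {x x' y y' : β} (hx : ReflTransGen W x x') (hy : ReflTransGen W y y') :
    ReflTransGen W (f x y) (f x' y') :=
  (hx.lift (fun z => f z y) fun _ _ h => hf h (hW y)).trans
    (hy.lift (f x') fun _ _ h => hf (hW x') h)

namespace AciStep

open Relation

variable {α : Type*}

theorem reflTransGen_alt {r r' s s' : Re α} (hr : ReflTransGen AciStep r r')
    (hs : ReflTransGen AciStep s s') : ReflTransGen AciStep (.Alt r s) (.Alt r' s') :=
  .lift_binary .refl .alt hr hs

theorem reflTransGen_conc {r r' s s' : Re α} (hr : ReflTransGen AciStep r r')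
    (hs : ReflTransGen AciStep s s') : ReflTransGen AciStep (.Conc r s) (.Conc r' s') :=
  .lift_binary .refl .conc hr hs

theorem reflTransGen_star {r r' : Re α} (hr : ReflTransGen AciStep r r') :
    ReflTransGen AciStep (.Star r) (.Star r') :=
  hr.lift Re.Star fun _ _ => .star

theorem reflTransGen_alt_alt_alt_comm (r s t u : Re α) :
    ReflTransGen AciStep (.Alt (.Alt r s) (.Alt t u)) (.Alt (.Alt r t) (.Alt s u)) := by
  refine .head (.assocR r s (.Alt t u)) ?_
  refine .head (.alt (.refl r) (.assocL s t u)) ?_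
  refine .head (.alt (.refl r) (.alt (.comm s t) (.refl u))) ?_
  refine .head (.alt (.refl r) (.assocR t s u)) ?_
  exact .single (.assocL r t (.Alt s u))

end AciStep

/-- Duplicate every subexpression that is not an alternative. -/
def Re.develop {α : Type*} : Re α → Re α
  | .Zero => .Alt .Zero .Zero
  | .Eps => .Alt .Eps .Eps
  | .Atom a => .Alt (.Atom a) (.Atom a)
  | .Alt r s => .Alt r.develop s.develop
  | .Conc r s => .Alt (.Conc r.develop s.develop) (.Conc r.develop s.develop)
  | .Star r => .Alt (.Star r.develop) (.Star r.develop)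

namespace AciStep

open Relation

variable {α : Type*}

theorem reflTransGen_develop (r : Re α) : ReflTransGen AciStep r r.develop := by
  induction r with
  | Zero => exact .single (.idem _)
  | Eps => exact .single (.idem _)
  | Atom a => exact .single (.idem _)
  | Alt r s hr hs => exact reflTransGen_alt hr hs
  | Conc r s hr hs => exact (reflTransGen_conc hr hs).tail (.idem _)
  | Star r hr => exact (reflTransGen_star hr).tail (.idem _)

theorem reflTransGen_alt_self_develop (r : Re α) :
    ReflTransGen AciStep (.Alt r r) r.develop := by
  induction r with
  | Zero => exact .refl
  | Eps => exact .refl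
  | Atom a => exact .refl
  | Alt r s hr hs =>
    exact (reflTransGen_alt_alt_alt_comm r s r s).trans (reflTransGen_alt hr hs)
  | Conc r s _ _ =>
    have h := reflTransGen_conc (reflTransGen_develop r) (reflTransGen_develop s)
    exact reflTransGen_alt h h
  | Star r _ =>
    have h := reflTransGen_star (reflTransGen_develop r)
    exact reflTransGen_alt h h

/-- Every one-step reduct of `r` reduces to `r.develop`. -/
theorem reflTransGen_develop_of_step {r s : Re α} (h : AciStep r s) :
    ReflTransGen AciStep s r.develop := by
  induction h with
  | assocR r s t => exact .head (.assocL r s t) (reflTransGen_develop _)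
  | assocL r s t => exact .head (.assocR r s t) (reflTransGen_develop _)
  | comm r s => exact .head (.comm s r) (reflTransGen_develop _)
  | idem r => exact reflTransGen_alt_self_develop r
  | refl r => exact reflTransGen_develop r
  | alt _ _ hr hs => exact reflTransGen_alt hr hs
  | conc _ _ hr hs => exact (reflTransGen_conc hr hs).tail (.idem _)
  | star _ hr => exact (reflTransGen_star hr).tail (.idem _)

theorem develop_mono_step {r s : Re α} (h : AciStep r s) :
    ReflTransGen AciStep r.develop s.develop := by
  induction h with
  | assocR r s t => exact .single (.assocR _ _ _)
  | assocL r s t => exact .single (.assocL _ _ _)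
  | comm r s => exact .single (.comm _ _)
  | idem r => exact .single (.idem _)
  | refl r => exact .refl
  | alt _ _ hr hs => exact reflTransGen_alt hr hs
  | conc _ _ hr hs =>
    exact reflTransGen_alt (reflTransGen_conc hr hs) (reflTransGen_conc hr hs)
  | star _ hr => exact reflTransGen_alt (reflTransGen_star hr) (reflTransGen_star hr)

theorem iterate_develop_mono (n : ℕ) {r s : Re α} (h : ReflTransGen AciStep r s) :
    ReflTransGen AciStep (Re.develop^[n] r) (Re.develop^[n] s) := by
  induction n generalizing r s with
  | zero => exact h
  | succ n ih => exact ih (h.lift' Re.develop fun _ _ => develop_mono_step)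

theorem reflTransGen_iterate_develop (n : ℕ) (r : Re α) :
    ReflTransGen AciStep r (Re.develop^[n] r) := by
  induction n generalizing r with
  | zero => exact .refl
  | succ n ih => exact (reflTransGen_develop r).trans (ih _)

/-- Iterated developments are cofinal among the reducts of an expression. -/
theorem exists_reflTransGen_iterate_develop {r s : Re α} (h : ReflTransGen AciStep r s) :
    ∃ n, ReflTransGen AciStep s (Re.develop^[n] r) := by
  induction h using ReflTransGen.head_induction_on with
  | refl => exact ⟨0, .refl⟩
  | head h _ ih =>
    obtain ⟨n, hn⟩ := ih
    exact ⟨n + 1, hn.trans (iterate_develop_mono n (reflTransGen_develop_of_step h))⟩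

end AciStep

/-- The relation `⇝aci` is confluent. -/
theorem aciStep_confluent {α : Type*} (r s t : Re α)
    (hrs : Relation.ReflTransGen AciStep r s)
    (hrt : Relation.ReflTransGen AciStep r t) :
    ∃ u, Relation.ReflTransGen AciStep s u ∧ Relation.ReflTransGen AciStep t u := by
  obtain ⟨m, hm⟩ := AciStep.exists_reflTransGen_iterate_develop hrs
  obtain ⟨n, hn⟩ := AciStep.exists_reflTransGen_iterate_develop hrt
  refine ⟨Re.develop^[m + n] r, ?_, ?_⟩
  · rw [Nat.add_comm, Function.iterate_add_apply]
    exact hm.trans (AciStep.reflTransGen_iterate_develop n _)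
  · rw [Function.iterate_add_apply]
    exact hn.trans (AciStep.reflTransGen_iterate_develop m _)
end

section
/- Let P be the equivalence family on sum types defined at every type β by: P u v iff u = v or both u and v are of the form Sum.inl. Then for every x : α, the quotient setter computed by the intersection formula satisfies: ⋂ over all y : Option α ⊕ Option α with P (Sum.inl (some x)) y of the sets {a | some a ∈ setSum y} is empty, while ⋂ over all y with P (Sum.inr (some x)) y of the sets {a | some a ∈ setSum y} equals {x}. Here setSum (Sum.inl b) = {b} and setSum (Sum.inr b) = {b}. -/
/-- The equivalence relation on `β ⊕ β` identifying all `Sum.inl`-values. -/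
def PRel {β : Type*} (u v : β ⊕ β) : Prop :=
  u = v ∨ ((∃ x, u = Sum.inl x) ∧ (∃ y, v = Sum.inl y))

/-- The setter of the functor `α ↦ α ⊕ α`. -/
def setSum {β : Type*} : β ⊕ β → Set β
  | Sum.inl b => {b}
  | Sum.inr b => {b}

/-- The quotient setter computed by the intersection formula is empty on the class of
`Sum.inl (some x)` and equals `{x}` on the class of `Sum.inr (some x)`. -/
theorem quotient_setter_sum_example {α : Type*} (x : α) :
    (⋂ y ∈ {y : Option α ⊕ Option α | PRel (Sum.inl (some x)) y},
        {a : α | some a ∈ setSum y}) = (∅ : Set α) ∧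
    (⋂ y ∈ {y : Option α ⊕ Option α | PRel (Sum.inr (some x)) y},
        {a : α | some a ∈ setSum y}) = {x} := by
  refine ⟨?_, ?_⟩
  · refine Set.eq_empty_of_forall_notMem fun a ha => ?_
    have h := Set.mem_iInter₂.1 ha (Sum.inl none) (Or.inr ⟨⟨_, rfl⟩, ⟨_, rfl⟩⟩)
    simp [setSum] at h
  · ext a
    simp [PRel, setSum]
end
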